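/- (Theorem 2, lower bounds: GHP lower bound is tighter than the Jensen–Shannon lower bound.) For m ≥ 3, ((m−1)/m)·[1 − (1 − (2m/(m−1)) Σ_{1≤i<j≤m} δ^m_ij)^{1/2}] ≥ (ε^m_JS)²/(m−1). Consequently ε^m ≥ ((m−1)/m)·[1 − (1 − (2m/(m−1)) Σ_{1≤i<j≤m} δ^m_ij)^{1/2}] ≥ (ε^m_JS)²/(m−1). -/

import Mathlib

open MeasureTheory Finset

/-- The mixture density `f⁽ᵐ⁾(x) = ∑ₖ pₖ fₖ(x)`. -/
noncomputable def mixture {m d : ℕ} (p : Fin m → ℝ) (f : Fin m → (Fin d → ℝ) → ℝ)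
    (x : Fin d → ℝ) : ℝ :=
  ∑ k, p k * f k x

/-- The multi-class Bayes error rate `ε^m = 1 - ∫ max_k pₖ fₖ(x) dx`. -/
noncomputable def bayesError {m d : ℕ} (p : Fin m → ℝ) (f : Fin m → (Fin d → ℝ) → ℝ) : ℝ :=
  1 - ∫ x : Fin d → ℝ, ⨆ k, p k * f k x

/-- `δ^m_ij = ∫ pᵢ pⱼ fᵢ(x) fⱼ(x) / f⁽ᵐ⁾(x) dx` (integrand `0` where the denominator is `0`). -/
noncomputable def deltaGHP {m d : ℕ} (p : Fin m → ℝ) (f : Fin m → (Fin d → ℝ) → ℝ)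
    (i j : Fin m) : ℝ :=
  ∫ x : Fin d → ℝ, p i * p j * f i x * f j x / mixture p f x

/-- `δ_ij = ∫ pᵢ pⱼ fᵢ(x) fⱼ(x) / (pᵢ fᵢ(x) + pⱼ fⱼ(x)) dx`
(integrand `0` where the denominator is `0`). -/
noncomputable def deltaPW {m d : ℕ} (p : Fin m → ℝ) (f : Fin m → (Fin d → ℝ) → ℝ)
    (i j : Fin m) : ℝ :=
  ∫ x : Fin d → ℝ, p i * p j * f i x * f j x / (p i * f i x + p j * f j x)

/-- The generalized Jensen–Shannon upper bound on the Bayes error: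
`ε^m_JS = -(1/2) ∫ ∑ₖ pₖ fₖ(x) log₂(pₖ fₖ(x) / f⁽ᵐ⁾(x)) dx`, with the convention
`0 · log₂ 0 = 0`.  It equals `(1/2)(H(p) - JS_p(f₁,…,f_m))`. -/
noncomputable def epsJS {m d : ℕ} (p : Fin m → ℝ) (f : Fin m → (Fin d → ℝ) → ℝ) : ℝ :=
  -(1 / 2) * ∫ x : Fin d → ℝ,
    ∑ k, p k * f k x * Real.logb 2 (p k * f k x / mixture p f x)

/-- `x (log₂ x)² ≤ (1 - x) (5/3 - x)` on `(0, 1]`. -/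
lemma mul_logb_sq_le {x : ℝ} (hx : 0 < x) (hx1 : x ≤ 1) :
    x * Real.logb 2 x ^ 2 ≤ (1 - x) * (5 / 3 - x) := by
  obtain ⟨s, hs⟩ : ∃ s : ℝ, s = -Real.log x / 4 := ⟨_, rfl⟩
  have hlog : Real.log x = -(4 * s) := by rw [hs]; ring
  have hs0 : 0 ≤ s := by
    have := Real.log_nonpos hx.le hx1
    linarith
  obtain ⟨w, hw⟩ : ∃ w : ℝ, w = Real.exp (-(2 * s)) := ⟨_, rfl⟩
  have hw0 : 0 < w := hw ▸ Real.exp_pos _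
  have hw1 : w ≤ 1 := by rw [hw]; exact Real.exp_le_one_iff.2 (by linarith)
  have hxw : x = w ^ 2 := by
    rw [← Real.exp_log hx, hlog, hw, ← Real.exp_nat_mul]
    congr 1
    push_cast
    ring
  have hsinh : s ^ 2 ≤ Real.sinh s ^ 2 := pow_le_pow_left₀ hs0 (Real.self_le_sinh_iff.2 hs0) 2
  have hw_sinh : w * Real.sinh s ^ 2 = (1 - w) ^ 2 / 4 := by
    have h1 : w = Real.exp (-s) ^ 2 := by
      rw [hw, ← Real.exp_nat_mul]
      congr 1
      push_cast
      ring
    have h2 : Real.exp s * Real.exp (-s) = 1 := by rw [← Real.exp_add]; simp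
    rw [h1, Real.sinh_eq]
    linear_combination ((Real.exp s * Real.exp (-s) + 1) / 4 - Real.exp (-s) ^ 2 / 2) * h2
  have hlog_sq : x * Real.log x ^ 2 ≤ 4 * w * (1 - w) ^ 2 := by
    have h : w * s ^ 2 ≤ (1 - w) ^ 2 / 4 :=
      hw_sinh ▸ mul_le_mul_of_nonneg_left hsinh hw0.le
    rw [hlog, hxw]
    nlinarith [mul_le_mul_of_nonneg_left h hw0.le]
  have hlog2 : (0.4804 : ℝ) ≤ Real.log 2 ^ 2 := by
    nlinarith [Real.log_two_gt_d9]
  have hcubic : 4 * w * (1 - w) ≤ 0.4804 * ((1 + w) * (5 / 3 - w ^ 2)) := by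
    nlinarith [mul_nonneg hw0.le (sq_nonneg (w - 0.53)), sq_nonneg (w - 0.53),
      mul_nonneg (sub_nonneg.2 hw1) (sq_nonneg (w - 0.53))]
  have hpoly : 4 * w * (1 - w) ^ 2 ≤ Real.log 2 ^ 2 * ((1 - x) * (5 / 3 - x)) := by
    have h1 := mul_le_mul_of_nonneg_left hcubic (sub_nonneg.2 hw1)
    have h2 : 0 ≤ (1 - x) * (5 / 3 - x) := mul_nonneg (by linarith) (by linarith)
    have h3 := mul_le_mul_of_nonneg_right hlog2 h2
    have h4 : (1 - x) * (5 / 3 - x) = (1 - w) * ((1 + w) * (5 / 3 - w ^ 2)) := by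
      rw [hxw]; ring
    rw [h4] at h3 ⊢
    linarith
  have hl : 0 < Real.log 2 ^ 2 := by linarith
  rw [Real.logb, div_pow, ← mul_div_assoc, div_le_iff₀ hl]
  linarith

/-- The squared Shannon entropy (in bits) of a distribution on `n ≥ 3` points is at most
`2 (n - 1)` times its Gini impurity. -/
lemma sq_entropy_le_gini {ι : Type*} [Fintype ι] (hcard : 3 ≤ Fintype.card ι)
    (η : ι → ℝ) (h0 : ∀ k, 0 ≤ η k) (h1 : ∑ k, η k = 1) :
    (∑ k, η k * Real.logb 2 (η k)) ^ 2 ≤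
      2 * ((Fintype.card ι : ℝ) - 1) * (1 - ∑ k, η k ^ 2) := by
  have hle : ∀ k, η k ≤ 1 := fun k =>
    h1 ▸ single_le_sum (fun i _ => h0 i) (mem_univ k)
  have hcard' : (3 : ℝ) ≤ Fintype.card ι := by exact_mod_cast hcard
  have hgini : ∑ k, η k * (1 - η k) = 1 - ∑ k, η k ^ 2 := by
    nth_rw 2 [← h1]
    rw [← sum_sub_distrib]
    exact sum_congr rfl fun k _ => by ring
  have hgini0 : 0 ≤ ∑ k, η k * (1 - η k) :=
    sum_nonneg fun k _ => mul_nonneg (h0 k) (sub_nonneg.2 (hle k))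
  have hlin : ∑ k, (5 / 3 - η k) = 5 / 3 * Fintype.card ι - 1 := by
    rw [sum_sub_distrib, h1]
    simp [mul_comm]
  have hcs : (∑ k, η k * Real.logb 2 (η k)) ^ 2 ≤
      (∑ k, η k * (1 - η k)) * ∑ k, (5 / 3 - η k) := by
    refine sum_sq_le_sum_mul_sum_of_sq_le_mul _
      (fun k _ => mul_nonneg (h0 k) (sub_nonneg.2 (hle k)))
      (fun k _ => by linarith [hle k]) fun k _ => ?_
    rcases (h0 k).eq_or_lt with hk | hk
    · simp [← hk]
    · have := mul_le_mul_of_nonneg_left (mul_logb_sq_le hk (hle k)) hk.le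
      nlinarith
  rw [hlin] at hcs
  rw [← hgini]
  nlinarith

/-- The Gini impurity controls the conditional error probability. -/
lemma sq_one_sub_error_le {ι : Type*} [Fintype ι] (hcard : 2 ≤ Fintype.card ι)
    (η : ι → ℝ) (h1 : ∑ k, η k = 1) (k₀ : ι) :
    (1 - Fintype.card ι / ((Fintype.card ι : ℝ) - 1) * (1 - η k₀)) ^ 2 ≤
      1 - Fintype.card ι / ((Fintype.card ι : ℝ) - 1) * (1 - ∑ k, η k ^ 2) := by
  classical
  have hn : (0 : ℝ) < (Fintype.card ι : ℝ) - 1 := by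
    have : (2 : ℝ) ≤ Fintype.card ι := by exact_mod_cast hcard
    linarith
  have hsum : ∑ k ∈ univ.erase k₀, η k = 1 - η k₀ := by
    rw [← h1, ← add_sum_erase univ η (mem_univ k₀)]; ring
  have hsq : ∑ k, η k ^ 2 = η k₀ ^ 2 + ∑ k ∈ univ.erase k₀, η k ^ 2 :=
    (add_sum_erase univ (fun k => η k ^ 2) (mem_univ k₀)).symm
  have hcs := sq_sum_le_card_mul_sum_sq (s := univ.erase k₀) (f := η)
  rw [hsum, card_erase_of_mem (mem_univ k₀), card_univ,
    Nat.cast_sub (by omega : 1 ≤ Fintype.card ι), Nat.cast_one] at hcs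
  rw [hsq]
  generalize (∑ k ∈ univ.erase k₀, η k ^ 2) = T at *
  generalize (Fintype.card ι : ℝ) = n at *
  have hc : n / (n - 1) = 1 + 1 / (n - 1) := by field_simp; ring
  have hc0 : 0 ≤ n / (n - 1) := by rw [hc]; positivity
  have hT : (1 - η k₀) ^ 2 * (1 / (n - 1)) ≤ T := by
    rw [mul_one_div, div_le_iff₀ hn]; linarith
  have key : 0 ≤ n / (n - 1) * (T - (1 - η k₀) ^ 2 * (n / (n - 1) - 1)) := by
    refine mul_nonneg hc0 ?_
    rw [hc]; linarith
  nlinarith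

/-- A symmetric double sum splits into its strict upper triangle and its diagonal. -/
lemma two_mul_sum_lt {ι : Type*} [Fintype ι] [LinearOrder ι] (b : ι → ι → ℝ)
    (hb : ∀ i j, b i j = b j i) :
    2 * ∑ i, ∑ j, (if i < j then b i j else 0) = ∑ i, ∑ j, b i j - ∑ i, b i i := by
  have hswap : ∑ i, ∑ j, (if i < j then b i j else 0) =
      ∑ i, ∑ j, (if j < i then b i j else 0) := by
    rw [sum_comm]
    simp_rw [hb]
  have hdiag : ∑ i, b i i = ∑ i, ∑ j, (if i = j then b i j else 0) := by simp
  rw [two_mul]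
  nth_rw 2 [hswap]
  rw [hdiag, ← sum_add_distrib, ← sum_sub_distrib]
  refine sum_congr rfl fun i _ => ?_
  rw [← sum_add_distrib, ← sum_sub_distrib]
  refine sum_congr rfl fun j _ => ?_
  rcases lt_trichotomy i j with h | h | h
  · simp [h, h.not_gt, h.ne]
  · simp [h]
  · simp [h, h.not_gt, h.ne']

/-- Homogeneous, linearised form of `sq_entropy_le_gini` for unnormalised weights. -/
lemma entropy_le_gini_homogeneous {ι : Type*} [Fintype ι] (hcard : 3 ≤ Fintype.card ι)
    (a : ι → ℝ) (h0 : ∀ k, 0 ≤ a k) (t : ℝ) :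
    2 * t * (∑ k, a k * Real.logb 2 (a k / ∑ i, a i)) - t ^ 2 * ∑ i, a i ≤
      2 * ((Fintype.card ι : ℝ) - 1) * (∑ i, a i - ∑ k, a k * a k / ∑ i, a i) := by
  rcases (sum_nonneg fun k _ => h0 k : 0 ≤ ∑ i, a i).eq_or_lt with hs | hs
  · have hz : ∀ k, a k = 0 := fun k =>
      (sum_eq_zero_iff_of_nonneg fun i _ => h0 i).1 hs.symm k (mem_univ k)
    simp [hz]
  · generalize hS : ∑ i, a i = S at *
    have h := sq_entropy_le_gini hcard (fun k => a k / S) (fun k => div_nonneg (h0 k) hs.le)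
      (by rw [← sum_div, hS, div_self hs.ne'])
    have e1 : ∑ k, a k * Real.logb 2 (a k / S) =
        S * ∑ k, a k / S * Real.logb 2 (a k / S) := by
      rw [mul_sum]
      exact sum_congr rfl fun k _ => by field_simp
    have e2 : ∑ k, a k * a k / S = S * ∑ k, (a k / S) ^ 2 := by
      rw [mul_sum]
      exact sum_congr rfl fun k _ => by field_simp
    rw [e1, e2]
    generalize (∑ k, a k / S * Real.logb 2 (a k / S)) = H at *
    nlinarith [mul_le_mul_of_nonneg_left h hs.le, mul_nonneg hs.le (sq_nonneg (H - t))]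

/-- Homogeneous, linearised form of `sq_one_sub_error_le` for unnormalised weights. -/
lemma error_le_gini_homogeneous {ι : Type*} [Fintype ι] (hcard : 2 ≤ Fintype.card ι)
    (a : ι → ℝ) (h0 : ∀ k, 0 ≤ a k) (t : ℝ) :
    2 * t * (∑ i, a i - Fintype.card ι / ((Fintype.card ι : ℝ) - 1) * (∑ i, a i - ⨆ k, a k)) -
        t ^ 2 * ∑ i, a i ≤
      ∑ i, a i - Fintype.card ι / ((Fintype.card ι : ℝ) - 1) *
        (∑ i, a i - ∑ k, a k * a k / ∑ i, a i) := by
  have : Nonempty ι := Fintype.card_pos_iff.1 (by omega)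
  obtain ⟨k₀, hk₀⟩ := exists_eq_ciSup_of_finite (f := a)
  rw [← hk₀]
  rcases (sum_nonneg fun k _ => h0 k : 0 ≤ ∑ i, a i).eq_or_lt with hs | hs
  · have hz : ∀ k, a k = 0 := fun k =>
      (sum_eq_zero_iff_of_nonneg fun i _ => h0 i).1 hs.symm k (mem_univ k)
    simp [hz]
  · generalize hS : ∑ i, a i = S at *
    have h := sq_one_sub_error_le hcard (fun k => a k / S)
      (by rw [← sum_div, hS, div_self hs.ne']) k₀
    have e1 : a k₀ = S * (a k₀ / S) := by field_simp
    have e2 : ∑ k, a k * a k / S = S * ∑ k, (a k / S) ^ 2 := by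
      rw [mul_sum]
      exact sum_congr rfl fun k _ => by field_simp
    rw [e1, e2]
    generalize a k₀ / S = M at *
    generalize (Fintype.card ι : ℝ) / (Fintype.card ι - 1) = c at *
    nlinarith [mul_le_mul_of_nonneg_left h hs.le,
      mul_nonneg hs.le (sq_nonneg (1 - c * (1 - M) - t))]

section Integrals

variable {m d : ℕ} {p : Fin m → ℝ} {f : Fin m → (Fin d → ℝ) → ℝ}

lemma integrable_weighted (hfint : ∀ k, ∫ x : Fin d → ℝ, f k x = 1) (k : Fin m) :
    Integrable fun x => p k * f k x := by
  refine Integrable.const_mul ?_ _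
  by_contra h
  have := hfint k
  rw [integral_undef h] at this
  exact zero_ne_one this

lemma integrable_mixture (hfint : ∀ k, ∫ x : Fin d → ℝ, f k x = 1) :
    Integrable (mixture p f) :=
  integrable_finsetSum _ fun k _ => integrable_weighted hfint k

lemma integral_mixture (hp1 : ∑ k, p k = 1) (hfint : ∀ k, ∫ x : Fin d → ℝ, f k x = 1) :
    ∫ x, mixture p f x = 1 := by
  unfold mixture
  rw [integral_finsetSum _ fun k _ => integrable_weighted hfint k]
  simp_rw [integral_const_mul, hfint, mul_one, hp1]

lemma measurable_mixture (hfmeas : ∀ k, Measurable (f k)) : Measurable (mixture p f) := by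
  unfold mixture
  fun_prop

lemma weighted_le_mixture (hp : ∀ k, 0 < p k) (hfnn : ∀ k x, 0 ≤ f k x) (k : Fin m)
    (x : Fin d → ℝ) : p k * f k x ≤ mixture p f x :=
  single_le_sum (f := fun k => p k * f k x) (fun i _ => mul_nonneg (hp i).le (hfnn i x))
    (mem_univ k)

lemma integrable_delta_integrand (hp : ∀ k, 0 < p k) (hfmeas : ∀ k, Measurable (f k))
    (hfnn : ∀ k x, 0 ≤ f k x) (hfint : ∀ k, ∫ x : Fin d → ℝ, f k x = 1) (i j : Fin m) :
    Integrable fun x => p i * p j * f i x * f j x / mixture p f x := by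
  refine (integrable_weighted (p := p) hfint i).mono' ?_ (ae_of_all _ fun x => ?_)
  · have := measurable_mixture (p := p) hfmeas
    exact Measurable.aestronglyMeasurable (by fun_prop)
  · have hi : 0 ≤ p i * f i x := mul_nonneg (hp i).le (hfnn i x)
    have hj : 0 ≤ p j * f j x := mul_nonneg (hp j).le (hfnn j x)
    have hjm := weighted_le_mixture hp hfnn j x
    have e : p i * p j * f i x * f j x / mixture p f x =
        p i * f i x * (p j * f j x / mixture p f x) := by ring
    rw [e, Real.norm_of_nonneg (mul_nonneg hi (div_nonneg hj (hj.trans hjm)))]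
    exact mul_le_of_le_one_right hi (div_le_one_of_le₀ hjm (hj.trans hjm))

lemma integrable_iSup_weighted (hm : 0 < m) (hp : ∀ k, 0 < p k)
    (hfmeas : ∀ k, Measurable (f k)) (hfnn : ∀ k x, 0 ≤ f k x)
    (hfint : ∀ k, ∫ x : Fin d → ℝ, f k x = 1) :
    Integrable fun x => ⨆ k, p k * f k x := by
  have : Nonempty (Fin m) := ⟨⟨0, hm⟩⟩
  refine (integrable_mixture (p := p) hfint).mono' ?_ (ae_of_all _ fun x => ?_)
  · exact (Measurable.iSup fun k => (hfmeas k).const_mul (p k)).aestronglyMeasurable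
  · rw [Real.norm_of_nonneg (Real.iSup_nonneg fun k => mul_nonneg (hp k).le (hfnn k x))]
    exact ciSup_le fun k => weighted_le_mixture hp hfnn k x

lemma integrable_entropy_integrand (hm : 3 ≤ m) (hp : ∀ k, 0 < p k)
    (hfmeas : ∀ k, Measurable (f k)) (hfnn : ∀ k x, 0 ≤ f k x)
    (hfint : ∀ k, ∫ x : Fin d → ℝ, f k x = 1) :
    Integrable fun x => ∑ k, p k * f k x * Real.logb 2 (p k * f k x / mixture p f x) := by
  refine ((integrable_mixture (p := p) hfint).const_mul (m : ℝ)).mono' ?_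
    (ae_of_all _ fun x => ?_)
  · have := measurable_mixture (p := p) hfmeas
    unfold Real.logb
    exact Measurable.aestronglyMeasurable (by fun_prop)
  · have h0 : ∀ k, 0 ≤ p k * f k x := fun k => mul_nonneg (hp k).le (hfnn k x)
    have hS : 0 ≤ mixture p f x := sum_nonneg fun k _ => h0 k
    have hQ : 0 ≤ ∑ k, p k * f k x * (p k * f k x) / mixture p f x :=
      sum_nonneg fun k _ => div_nonneg (mul_nonneg (h0 k) (h0 k)) hS
    have hm' : (3 : ℝ) ≤ m := by exact_mod_cast hm
    have h := entropy_le_gini_homogeneous (by simpa using hm) (fun k => p k * f k x) h0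
    simp only [Fintype.card_fin] at h
    change ∀ t, 2 * t * (∑ k, p k * f k x * Real.logb 2 (p k * f k x / mixture p f x)) -
      t ^ 2 * mixture p f x ≤ 2 * ((m : ℝ) - 1) * (mixture p f x -
        ∑ k, p k * f k x * (p k * f k x) / mixture p f x) at h
    have hmQ := mul_nonneg (by linarith : (0 : ℝ) ≤ 2 * ((m : ℝ) - 1)) hQ
    have h1 := h 1
    have h2 := h (-1)
    rw [Real.norm_eq_abs, abs_le]
    constructor <;> nlinarith

lemma two_mul_sum_deltaGHP (hp : ∀ k, 0 < p k) (hp1 : ∑ k, p k = 1)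
    (hfmeas : ∀ k, Measurable (f k)) (hfnn : ∀ k x, 0 ≤ f k x)
    (hfint : ∀ k, ∫ x : Fin d → ℝ, f k x = 1) :
    2 * ∑ i, ∑ j, (if i < j then deltaGHP p f i j else 0) =
      1 - ∫ x, ∑ k, p k * f k x * (p k * f k x) / mixture p f x := by
  have hint := integrable_delta_integrand hp hfmeas hfnn hfint
  rw [two_mul_sum_lt]
  · congr 1
    · unfold deltaGHP
      simp_rw [← integral_finsetSum univ fun j _ => hint _ j]
      rw [← integral_finsetSum univ fun i _ => integrable_finsetSum univ fun j _ => hint i j,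
        ← integral_mixture (p := p) hp1 hfint]
      congr 1
      ext x
      have e : ∀ i j, p i * p j * f i x * f j x / mixture p f x =
          p i * f i x * (p j * f j x) / mixture p f x := fun i j => by ring
      simp_rw [e, ← sum_div, ← mul_sum, ← sum_mul]
      exact mul_self_div_self (mixture p f x)
    · unfold deltaGHP
      rw [← integral_finsetSum univ fun i _ => hint i i]
      congr 1
      ext x
      exact sum_congr rfl fun i _ => by ring
  · intro i j
    unfold deltaGHP
    congr 1
    ext x
    ring

end Integrals

theorem GHP_lower_tighter_than_JS_lower
    (m d : ℕ) (hm : 3 ≤ m) (hd : 1 ≤ d)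
    (p : Fin m → ℝ) (hp : ∀ k, 0 < p k) (hp1 : ∑ k, p k = 1)
    (f : Fin m → (Fin d → ℝ) → ℝ)
    (hfmeas : ∀ k, Measurable (f k))
    (hfnn : ∀ k x, 0 ≤ f k x)
    (hfint : ∀ k, ∫ x : Fin d → ℝ, f k x = 1) :
    bayesError p f ≥
      ((m : ℝ) - 1) / m *
        (1 - Real.sqrt (1 - (2 * m / ((m : ℝ) - 1)) *
          ∑ i : Fin m, ∑ j : Fin m, (if i < j then deltaGHP p f i j else 0))) ∧
      ((m : ℝ) - 1) / m *
        (1 - Real.sqrt (1 - (2 * m / ((m : ℝ) - 1)) *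
          ∑ i : Fin m, ∑ j : Fin m, (if i < j then deltaGHP p f i j else 0))) ≥
        (epsJS p f) ^ 2 / ((m : ℝ) - 1) := by
  have hm' : (3 : ℝ) ≤ m := by exact_mod_cast hm
  have h0 : ∀ x k, 0 ≤ p k * f k x := fun x k => mul_nonneg (hp k).le (hfnn k x)
  have hS := integrable_mixture (p := p) hfint
  have hS1 := integral_mixture (p := p) hp1 hfint
  have hsup := integrable_iSup_weighted (by omega) hp hfmeas hfnn hfint
  have hent := integrable_entropy_integrand hm hp hfmeas hfnn hfint
  have hQ : Integrable fun x => ∑ k, p k * f k x * (p k * f k x) / mixture p f x := by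
    refine integrable_finsetSum _ fun k _ => ?_
    refine (integrable_delta_integrand hp hfmeas hfnn hfint k k).congr (ae_of_all _ fun x => ?_)
    ring
  have hSsup : Integrable fun x => mixture p f x - ⨆ k, p k * f k x := hS.sub hsup
  have hSQ : Integrable fun x => mixture p f x -
      ∑ k, p k * f k x * (p k * f k x) / mixture p f x := hS.sub hQ
  have hD := two_mul_sum_deltaGHP hp hp1 hfmeas hfnn hfint
  generalize (∑ i : Fin m, ∑ j : Fin m, (if i < j then deltaGHP p f i j else 0)) = D at *
  obtain ⟨c, hc⟩ : ∃ c : ℝ, c = (m : ℝ) / (m - 1) := ⟨_, rfl⟩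
  have hc0 : 0 < c := hc ▸ div_pos (by linarith) (by linarith)
  have hc_inv : ((m : ℝ) - 1) / m = 1 / c := by rw [hc, one_div_div]
  have hcD : 2 * m / ((m : ℝ) - 1) * D = c * (2 * D) := by rw [hc]; ring
  have hA : Integrable fun x =>
      mixture p f x - c * (mixture p f x - ⨆ k, p k * f k x) := hS.sub (hSsup.const_mul c)
  have herr : ∀ t : ℝ, 2 * t * (1 - c * bayesError p f) - t ^ 2 ≤ 1 - c * (2 * D) := by
    intro t
    have h : ∫ x, (2 * t * (mixture p f x - c * (mixture p f x - ⨆ k, p k * f k x)) -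
          t ^ 2 * mixture p f x) ≤
        ∫ x, (mixture p f x - c * (mixture p f x -
          ∑ k, p k * f k x * (p k * f k x) / mixture p f x)) := by
      refine integral_mono
        ((hA.const_mul (2 * t)).sub (hS.const_mul (t ^ 2))) (hS.sub (hSQ.const_mul c)) fun x => ?_
      have := error_le_gini_homogeneous (by simp; omega) (fun k => p k * f k x) (h0 x) t
      simp only [Fintype.card_fin, ← hc] at this
      exact this
    rw [integral_sub (hA.const_mul (2 * t)) (hS.const_mul (t ^ 2)), integral_const_mul,
      integral_const_mul, integral_sub hS (hSsup.const_mul c), integral_const_mul,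
      integral_sub hS hsup, integral_sub hS (hSQ.const_mul c), integral_const_mul, integral_sub hS hQ,
      hS1, ← hD] at h
    unfold bayesError
    linarith
  have hentropy : ∀ t : ℝ,
      2 * t * (-2 * epsJS p f) - t ^ 2 ≤ 2 * ((m : ℝ) - 1) * (2 * D) := by
    intro t
    have h : ∫ x, (2 * t * (∑ k, p k * f k x * Real.logb 2 (p k * f k x / mixture p f x)) -
          t ^ 2 * mixture p f x) ≤
        ∫ x, 2 * ((m : ℝ) - 1) * (mixture p f x -
          ∑ k, p k * f k x * (p k * f k x) / mixture p f x) := by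
      refine integral_mono ((hent.const_mul (2 * t)).sub (hS.const_mul (t ^ 2)))
        (hSQ.const_mul _) fun x => ?_
      have := entropy_le_gini_homogeneous (by simpa using hm) (fun k => p k * f k x) (h0 x) t
      simp only [Fintype.card_fin] at this
      exact this
    rw [integral_sub (hent.const_mul (2 * t)) (hS.const_mul (t ^ 2)), integral_const_mul,
      integral_const_mul, integral_const_mul, integral_sub hS hQ, hS1, ← hD] at h
    unfold epsJS
    linarith
  rw [hcD, hc_inv]
  constructor
  · have hsq : (1 - c * bayesError p f) ^ 2 ≤ 1 - c * (2 * D) := by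
      linarith [herr (1 - c * bayesError p f)]
    have := (le_abs_self _).trans (Real.abs_le_sqrt hsq)
    rw [ge_iff_le, one_div_mul_eq_div, div_le_iff₀ hc0]
    linarith
  · have hJ : epsJS p f ^ 2 / ((m : ℝ) - 1) ≤ D := by
      rw [div_le_iff₀ (by linarith)]
      linarith [hentropy (-2 * epsJS p f)]
    have hsq0 : 0 ≤ 1 - c * (2 * D) :=
      (sq_nonneg (1 - c * bayesError p f)).trans
        (by linarith [herr (1 - c * bayesError p f)])
    have hsqrt : Real.sqrt (1 - c * (2 * D)) ≤ 1 - c * D := by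
      rw [Real.sqrt_le_left (by linarith)]
      nlinarith [sq_nonneg (c * D)]
    refine hJ.trans ?_
    rw [one_div_mul_eq_div, le_div_iff₀ hc0]
    linarith
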